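/- arXiv:2207.12242 — 2 statements merged into one kernel-verified Lean document; each statement's English description precedes it below -/
import Mathlib

section
/- Euler–Poincaré reduction of the mean-field optimality system (coordinate form of Theorem 3.1): Let n ≥ 1 and let ρ, λ, h : ℝⁿ × ℝ → ℝ and a vector field F : ℝⁿ × ℝ → ℝⁿ (with components F^j) all be smooth. Assume that on all of ℝⁿ × ℝ the continuity equation ∂_t ρ + Σ_j ∂_j(ρ F^j) = 0 and the Hamilton–Jacobi–Bellman-type equation ∂_t λ + Σ_j F^j ∂_j λ = h hold. Define the momentum density m : ℝⁿ × ℝ → ℝⁿ by m_i := ρ ∂_i λ. Then m satisfies the Euler–Poincaré equation with advected density: for every i = 1,…,n, ∂_t m_i + Σ_j ∂_j(m_i F^j) + Σ_j m_j ∂_i F^j = ρ ∂_i h on ℝⁿ × ℝ. -/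
open Real

/-- Partial derivative in the time variable of `u : ℝⁿ × ℝ → ℝ`. -/
noncomputable def pderivT (n : ℕ) (u : (Fin n → ℝ) × ℝ → ℝ) (p : (Fin n → ℝ) × ℝ) : ℝ :=
  deriv (fun s => u (p.1, s)) p.2

/-- Partial derivative in the `i`-th spatial coordinate of `u : ℝⁿ × ℝ → ℝ`. -/
noncomputable def pderivX (n : ℕ) (i : Fin n) (u : (Fin n → ℝ) × ℝ → ℝ)
    (p : (Fin n → ℝ) × ℝ) : ℝ :=
  deriv (fun s => u (Function.update p.1 i s, p.2)) (p.1 i)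

section DirectionalDerivative

variable {E : Type*} [NormedAddCommGroup E] [NormedSpace ℝ E]

theorem ContDiff.fderiv_apply_const {u : E → ℝ} (hu : ContDiff ℝ (⊤ : ℕ∞) u) (v : E) :
    ContDiff ℝ (⊤ : ℕ∞) fun q => fderiv ℝ u q v :=
  (hu.fderiv_right (m := (⊤ : ℕ∞)) le_rfl).clm_apply contDiff_const

theorem fderiv_fderiv_apply_comm {u : E → ℝ} (hu : ContDiff ℝ (⊤ : ℕ∞) u) (v w p : E) :
    fderiv ℝ (fun q => fderiv ℝ u q v) p w = fderiv ℝ (fun q => fderiv ℝ u q w) p v := by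
  have hd : DifferentiableAt ℝ (fderiv ℝ u) p :=
    (hu.fderiv_right (m := (⊤ : ℕ∞)) le_rfl).differentiable (by simp) p
  have hs : IsSymmSndFDerivAt ℝ u p :=
    hu.contDiffAt.isSymmSndFDerivAt
      (by rw [minSmoothness_of_isRCLikeNormedField]; exact WithTop.coe_le_coe.2 (le_top : (2 : ℕ∞) ≤ ⊤))
  rw [fderiv_clm_apply hd (differentiableAt_const v),
    fderiv_clm_apply hd (differentiableAt_const w)]
  simpa using hs w v

theorem fderiv_mul_apply {f g : E → ℝ} {p : E} (hf : DifferentiableAt ℝ f p)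
    (hg : DifferentiableAt ℝ g p) (v : E) :
    fderiv ℝ (fun q => f q * g q) p v = f p * fderiv ℝ g p v + fderiv ℝ f p v * g p := by
  rw [fderiv_fun_mul hf hg]
  simp [mul_comm]

end DirectionalDerivative

theorem pderivT_eq_fderiv {n : ℕ} {u : (Fin n → ℝ) × ℝ → ℝ} (hu : Differentiable ℝ u) :
    pderivT n u = fun p => fderiv ℝ u p (0, 1) := by
  funext p
  have hc : HasDerivAt (fun s : ℝ => (p.1, s)) (0, 1) p.2 :=
    (hasDerivAt_const p.2 p.1).prodMk (hasDerivAt_id p.2)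
  exact ((hu p).hasFDerivAt.comp_hasDerivAt p.2 hc).deriv

theorem pderivX_eq_fderiv {n : ℕ} (i : Fin n) {u : (Fin n → ℝ) × ℝ → ℝ}
    (hu : Differentiable ℝ u) :
    pderivX n i u = fun p => fderiv ℝ u p (Pi.single i 1, 0) := by
  funext p
  have hc : HasDerivAt (fun s : ℝ => (Function.update p.1 i s, p.2)) (Pi.single i 1, 0) (p.1 i) :=
    (hasDerivAt_update p.1 i (p.1 i)).prodMk (hasDerivAt_const (p.1 i) p.2)
  have hp : (Function.update p.1 i (p.1 i), p.2) = p := by simp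
  exact ((hp.symm ▸ (hu p).hasFDerivAt :
    HasFDerivAt u (fderiv ℝ u p) (Function.update p.1 i (p.1 i), p.2)).comp_hasDerivAt
      (p.1 i) hc).deriv

/-- Euler–Poincaré reduction of the mean-field optimality system: if `ρ` satisfies the
continuity equation with drift `F`, `λ` satisfies the HJB-type equation
`∂_t λ + Σ_j F^j ∂_j λ = h`, and `m_i = ρ ∂_i λ`, then `m` satisfies the Euler–Poincaré
equation with advected density. -/
theorem euler_poincare_reduction (n : ℕ) (hn : 1 ≤ n)
    (ρ lam h : (Fin n → ℝ) × ℝ → ℝ) (F : (Fin n → ℝ) × ℝ → Fin n → ℝ)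
    (hρ : ContDiff ℝ (⊤ : ℕ∞) ρ) (hlam : ContDiff ℝ (⊤ : ℕ∞) lam) (hh : ContDiff ℝ (⊤ : ℕ∞) h)
    (hF : ContDiff ℝ (⊤ : ℕ∞) F)
    (hcont : ∀ p, pderivT n ρ p + ∑ j, pderivX n j (fun q => ρ q * F q j) p = 0)
    (hhjb : ∀ p, pderivT n lam p + ∑ j, F p j * pderivX n j lam p = h p)
    (m : (Fin n → ℝ) × ℝ → Fin n → ℝ)
    (hm : ∀ p i, m p i = ρ p * pderivX n i lam p) :
    ∀ p (i : Fin n),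
      pderivT n (fun q => m q i) p + (∑ j, pderivX n j (fun q => m q i * F q j) p)
        + (∑ j, m p j * pderivX n i (fun q => F q j) p) = ρ p * pderivX n i h p := by
  intro p i
  have hFj : ∀ j, ContDiff ℝ (⊤ : ℕ∞) fun q => F q j := contDiff_pi.mp hF
  have dρ : Differentiable ℝ ρ := hρ.differentiable (by simp)
  have dlam : Differentiable ℝ lam := hlam.differentiable (by simp)
  have dh : Differentiable ℝ h := hh.differentiable (by simp)
  have dF : ∀ j, Differentiable ℝ fun q => F q j := fun j => (hFj j).differentiable (by simp)
  have dD : ∀ v, Differentiable ℝ fun q => fderiv ℝ lam q v :=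
    fun v => (hlam.fderiv_apply_const v).differentiable (by simp)
  have dρF : ∀ j, Differentiable ℝ fun q => ρ q * F q j := fun j => dρ.mul (dF j)
  simp only [pderivX_eq_fderiv _ dlam] at hm
  simp only [pderivT_eq_fderiv dlam, pderivX_eq_fderiv _ dlam] at hhjb
  have hc := hcont p
  simp only [pderivT_eq_fderiv dρ, pderivX_eq_fderiv _ (dρF _)] at hc
  have hmT : pderivT n (fun q => m q i) p
      = ρ p * fderiv ℝ (fun q => fderiv ℝ lam q (0, 1)) p (Pi.single i 1, 0)
        + fderiv ℝ ρ p (0, 1) * fderiv ℝ lam p (Pi.single i 1, 0) := by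
    simp only [hm]
    rw [pderivT_eq_fderiv (dρ.fun_mul (dD _)), fderiv_fderiv_apply_comm hlam]
    exact fderiv_mul_apply (dρ p) (dD _ p) _
  have hmX : ∀ j, pderivX n j (fun q => m q i * F q j) p
      = ρ p * (F p j * fderiv ℝ (fun q => fderiv ℝ lam q (Pi.single j 1, 0)) p (Pi.single i 1, 0))
        + fderiv ℝ (fun q => ρ q * F q j) p (Pi.single j 1, 0)
          * fderiv ℝ lam p (Pi.single i 1, 0) := by
    intro j
    have he : (fun q => m q i * F q j)
        = fun q => (ρ q * F q j) * fderiv ℝ lam q (Pi.single i 1, 0) := by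
      funext q
      rw [hm]
      ring
    rw [he, pderivX_eq_fderiv j ((dρF j).fun_mul (dD _)), fderiv_fderiv_apply_comm hlam, ← mul_assoc]
    exact fderiv_mul_apply (dρF j p) (dD _ p) _
  have hhX : pderivX n i h p
      = fderiv ℝ (fun q => fderiv ℝ lam q (0, 1)) p (Pi.single i 1, 0)
        + ∑ j, (F p j * fderiv ℝ (fun q => fderiv ℝ lam q (Pi.single j 1, 0)) p (Pi.single i 1, 0)
          + fderiv ℝ (fun q => F q j) p (Pi.single i 1, 0)
            * fderiv ℝ lam p (Pi.single j 1, 0)) := by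
    have hd : ∀ j, DifferentiableAt ℝ
        (fun q => F q j * fderiv ℝ lam q (Pi.single j 1, 0)) p := fun j => (dF j p).mul (dD _ p)
    simp only [pderivX_eq_fderiv i dh]
    rw [← funext hhjb, fderiv_fun_add (dD _ p) (DifferentiableAt.fun_sum fun j _ => hd j),
      fderiv_fun_sum fun j _ => hd j]
    simp only [add_apply, sum_apply,
      fderiv_mul_apply (dF _ p) (dD _ p)]
  rw [hmT, hhX, Finset.sum_congr rfl fun j _ => hmX j]
  simp only [pderivX_eq_fderiv _ (dF _), hm, Finset.sum_add_distrib, mul_add, Finset.mul_sum,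
    ← Finset.sum_mul]
  have hs : ∑ j, ρ p * fderiv ℝ lam p (Pi.single j 1, 0)
        * fderiv ℝ (fun q => F q j) p (Pi.single i 1, 0)
      = ∑ j, ρ p * (fderiv ℝ (fun q => F q j) p (Pi.single i 1, 0)
        * fderiv ℝ lam p (Pi.single j 1, 0)) :=
    Finset.sum_congr rfl fun j _ => by ring
  rw [hs]
  linear_combination fderiv ℝ lam p (Pi.single i 1, 0) * hc
end

section
/- Infinitesimal equivariance of the momentum map J(ρ, λ) = ρ∇λ: Let n ≥ 1 and let ρ, λ : ℝⁿ → ℝ be smooth compactly supported functions and η, β : ℝⁿ → ℝⁿ smooth compactly supported vector fields. Then ∫_{ℝⁿ} [ Σ_{i,j} ∂_j(ρ η^j)(∂_i λ) β^i + ρ Σ_{i,j} ∂_j((∂_i λ) η^i) β^j ] dx = ∫_{ℝⁿ} ρ Σ_{i,j} (∂_j λ)(β^i ∂_i η^j − η^i ∂_i β^j) dx. (Equivalently, {J_η, J_β} = J_{[η,β]}, where J_β(ρ,λ) = ∫ ρ (∂_i λ) β^i dx and [η,β] is the Lie bracket of vector fields.) -/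
open Real MeasureTheory

/-- Partial derivative in the `i`-th coordinate of `u : ℝⁿ → ℝ`. -/
noncomputable def pderiv (n : ℕ) (i : Fin n) (u : (Fin n → ℝ) → ℝ) (x : Fin n → ℝ) : ℝ :=
  deriv (fun s => u (Function.update x i s)) (x i)

theorem pderiv_eq_fderiv {n : ℕ} (i : Fin n) {u : (Fin n → ℝ) → ℝ} {x : Fin n → ℝ}
    (hu : DifferentiableAt ℝ u x) : pderiv n i u x = fderiv ℝ u x (Pi.single i 1) := by
  have hu' : HasFDerivAt u (fderiv ℝ u x) (Function.update x i (x i)) := by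
    simpa using hu.hasFDerivAt
  exact (hu'.comp_hasDerivAt (x i) (hasDerivAt_update x i (x i))).deriv

theorem pderiv_fun_eq_fderiv {n : ℕ} (i : Fin n) {u : (Fin n → ℝ) → ℝ}
    (hu : ContDiff ℝ (⊤ : ℕ∞) u) : pderiv n i u = fun x => fderiv ℝ u x (Pi.single i 1) :=
  funext fun x => pderiv_eq_fderiv i (hu.differentiable (by simp) x)

theorem contDiff_pderiv {n : ℕ} (i : Fin n) {u : (Fin n → ℝ) → ℝ}
    (hu : ContDiff ℝ (⊤ : ℕ∞) u) : ContDiff ℝ (⊤ : ℕ∞) (pderiv n i u) := by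
  rw [pderiv_fun_eq_fderiv i hu]
  exact (hu.fderiv_right (m := (⊤ : ℕ∞)) (by simp)).clm_apply contDiff_const

theorem pderiv_mul {n : ℕ} (i : Fin n) {u v : (Fin n → ℝ) → ℝ}
    (hu : ContDiff ℝ (⊤ : ℕ∞) u) (hv : ContDiff ℝ (⊤ : ℕ∞) v) (x : Fin n → ℝ) :
    pderiv n i (fun y => u y * v y) x = pderiv n i u x * v x + u x * pderiv n i v x := by
  have hu' := hu.differentiable (by simp) x
  have hv' := hv.differentiable (by simp) x
  rw [pderiv_eq_fderiv i hu', pderiv_eq_fderiv i hv', pderiv_eq_fderiv i (hu'.fun_mul hv'),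
    fderiv_fun_mul hu' hv']
  simp
  ring

theorem pderiv_comm {n : ℕ} (i j : Fin n) {u : (Fin n → ℝ) → ℝ}
    (hu : ContDiff ℝ (⊤ : ℕ∞) u) (x : Fin n → ℝ) :
    pderiv n i (pderiv n j u) x = pderiv n j (pderiv n i u) x := by
  have hd : DifferentiableAt ℝ (fderiv ℝ u) x :=
    (hu.fderiv_right (m := (⊤ : ℕ∞)) (by simp)).differentiable (by simp) x
  have key : ∀ k l : Fin n, pderiv n k (pderiv n l u) x =
      fderiv ℝ (fderiv ℝ u) x (Pi.single k 1) (Pi.single l 1) := fun k l => by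
    rw [pderiv_eq_fderiv k ((contDiff_pderiv l hu).differentiable (by simp) x),
      pderiv_fun_eq_fderiv l hu, fderiv_clm_apply hd (differentiableAt_const _)]
    simp
  rw [key, key]
  exact (contDiff_infty.1 hu 2).contDiffAt.isSymmSndFDerivAt (by simp) _ _

theorem integrable_pderiv {n : ℕ} (i : Fin n) {u : (Fin n → ℝ) → ℝ}
    (hu : ContDiff ℝ (⊤ : ℕ∞) u) (huc : HasCompactSupport u) : Integrable (pderiv n i u) := by
  refine (contDiff_pderiv i hu).continuous.integrable_of_hasCompactSupport ?_
  rw [pderiv_fun_eq_fderiv i hu]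
  exact huc.fderiv_apply ℝ _

theorem integral_pderiv_eq_zero {n : ℕ} (i : Fin n) {u : (Fin n → ℝ) → ℝ}
    (hu : ContDiff ℝ (⊤ : ℕ∞) u) (huc : HasCompactSupport u) : ∫ x, pderiv n i u x = 0 := by
  have hdu := integrable_pderiv i hu huc
  rw [pderiv_fun_eq_fderiv i hu] at hdu ⊢
  have h := integral_mul_fderiv_eq_neg_fderiv_mul_of_integrable (μ := volume)
    (f := fun _ : Fin n → ℝ => (1 : ℝ)) (g := u) (v := Pi.single i 1) (by simp)
    (by simpa using hdu) (by simpa using hu.continuous.integrable_of_hasCompactSupport huc)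
    (fun x _ => differentiableAt_const _) (fun x _ => hu.differentiable (by simp) x)
  simpa using h

/-- Infinitesimal equivariance of the momentum map `J(ρ, λ) = ρ∇λ`:
`{J_η, J_β} = J_{[η,β]}` in coordinates. -/
theorem momentum_map_infinitesimal_equivariance (n : ℕ) (hn : 1 ≤ n)
    (ρ lam : (Fin n → ℝ) → ℝ) (η β : (Fin n → ℝ) → Fin n → ℝ)
    (hρ : ContDiff ℝ (⊤ : ℕ∞) ρ) (hlam : ContDiff ℝ (⊤ : ℕ∞) lam)
    (hη : ContDiff ℝ (⊤ : ℕ∞) η) (hβ : ContDiff ℝ (⊤ : ℕ∞) β)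
    (hρc : HasCompactSupport ρ) (hlamc : HasCompactSupport lam)
    (hηc : HasCompactSupport η) (hβc : HasCompactSupport β) :
    (∫ x, ((∑ i, ∑ j, pderiv n j (fun y => ρ y * η y j) x * pderiv n i lam x * β x i)
        + ρ x * ∑ j, ∑ i, pderiv n j (fun y => pderiv n i lam y * η y i) x * β x j))
      = ∫ x, ρ x * ∑ j, ∑ i, pderiv n j lam x *
          (β x i * pderiv n i (fun y => η y j) x - η x i * pderiv n i (fun y => β y j) x) := by
  have hηi : ∀ i, ContDiff ℝ (⊤ : ℕ∞) fun y => η y i := contDiff_pi.1 hη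
  have hβi : ∀ i, ContDiff ℝ (⊤ : ℕ∞) fun y => β y i := contDiff_pi.1 hβ
  have hL : ∀ i, ContDiff ℝ (⊤ : ℕ∞) (pderiv n i lam) := fun i => contDiff_pderiv i hlam
  have hρη : ∀ j, ContDiff ℝ (⊤ : ℕ∞) fun y => ρ y * η y j := fun j => hρ.mul (hηi j)
  have hLβ : ∀ i, ContDiff ℝ (⊤ : ℕ∞) fun y => pderiv n i lam y * β y i :=
    fun i => (hL i).mul (hβi i)
  let F : Fin n → Fin n → (Fin n → ℝ) → ℝ :=
    fun i j y => (ρ y * η y j) * (pderiv n i lam y * β y i)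
  have hF : ∀ i j, ContDiff ℝ (⊤ : ℕ∞) (F i j) := fun i j => (hρη j).mul (hLβ i)
  have hFc : ∀ i j, HasCompactSupport (F i j) := fun i j => hρc.mul_right.mul_right
  have hsplit : ∀ x,
      ((∑ i, ∑ j, pderiv n j (fun y => ρ y * η y j) x * pderiv n i lam x * β x i)
        + ρ x * ∑ j, ∑ i, pderiv n j (fun y => pderiv n i lam y * η y i) x * β x j)
      = (ρ x * ∑ j, ∑ i, pderiv n j lam x *
          (β x i * pderiv n i (fun y => η y j) x - η x i * pderiv n i (fun y => β y j) x))
        + ∑ i, ∑ j, pderiv n j (F i j) x := by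
    intro x
    have hdF : ∀ i j, pderiv n j (F i j) x =
        pderiv n j (fun y => ρ y * η y j) x * pderiv n i lam x * β x i
        + ρ x * (η x j * β x i * pderiv n j (pderiv n i lam) x)
        + ρ x * (pderiv n i lam x * (η x j * pderiv n j (fun y => β y i) x)) := fun i j => by
      rw [pderiv_mul j (hρη j) (hLβ i), pderiv_mul j (hL i) (hβi i)]
      ring
    have hdL : ∀ j i, pderiv n j (fun y => pderiv n i lam y * η y i) x * β x j =
        η x i * β x j * pderiv n i (pderiv n j lam) x
        + pderiv n i lam x * (β x j * pderiv n j (fun y => η y i) x) := fun j i => by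
      rw [pderiv_mul j (hL i) (hηi i), pderiv_comm j i hlam]
      ring
    simp only [hdF, hdL, mul_sub, Finset.sum_add_distrib, Finset.sum_sub_distrib, mul_add,
      ← Finset.mul_sum]
    rw [Finset.sum_comm (f := fun j i => pderiv n i lam x *
      (β x j * pderiv n j (fun y => η y i) x))]
    simp only [← Finset.mul_sum]
    ring
  have hdFi : ∀ i j, Integrable (pderiv n j (F i j)) :=
    fun i j => integrable_pderiv j (hF i j) (hFc i j)
  have hcont : Continuous fun x => ∑ j, ∑ i, pderiv n j lam x *
      (β x i * pderiv n i (fun y => η y j) x - η x i * pderiv n i (fun y => β y j) x) :=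
    continuous_finsetSum _ fun j _ => continuous_finsetSum _ fun i _ =>
      (hL j).continuous.mul
        (((hβi i).continuous.mul (contDiff_pderiv i (hηi j)).continuous).sub
          ((hηi i).continuous.mul (contDiff_pderiv i (hβi j)).continuous))
  have hRHS : Integrable fun x => ρ x * ∑ j, ∑ i, pderiv n j lam x *
      (β x i * pderiv n i (fun y => η y j) x - η x i * pderiv n i (fun y => β y j) x) :=
    (hρ.continuous.mul hcont).integrable_of_hasCompactSupport hρc.mul_right
  simp only [hsplit]
  rw [integral_add hRHS
    (integrable_finsetSum _ fun i _ => integrable_finsetSum _ fun j _ => hdFi i j),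
    integral_finsetSum _ fun i _ => integrable_finsetSum _ fun j _ => hdFi i j]
  simp only [integral_finsetSum _ fun j _ => hdFi _ j,
    fun i j => integral_pderiv_eq_zero j (hF i j) (hFc i j), Finset.sum_const_zero, add_zero]
end
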